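/- arXiv:hep-th/0606280 — 3 statements merged into one kernel-verified Lean document; each statement's English description precedes it below -/
import Mathlib

section
/- Crossing relation for the fused L-operator: on ℂ²_a ⊗ ℂ²_j ⊗ ℂ²_{j̄} (i.e. as 8×8 matrices over R), 𝒫⁻_{j,j̄} · L⁺_{{A,a},j}(ζq⁻¹) · L⁺_{{A,a},j̄}(ζ) = (ζq − ζ⁻¹q⁻¹)(ζ − ζ⁻¹)(ζq⁻¹ − ζ⁻¹q) · 𝒫⁻_{j,j̄}, where 𝒫⁻_{j,j̄} := ½(1 − P_{j,j̄}) is the antisymmetrizer of the two quantum spaces j, j̄ (acting as identity on a), and L⁺_{{A,a},j}(x), L⁺_{{A,a},j̄}(x) denote the fused L-operator acting in a ⊗ j (resp. a ⊗ j̄) and as identity on the remaining factor. -/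
open Matrix

/-- The q-oscillator L-operator `L⁺(x)` at `x = r²`, with chosen square root `x^{1/2} = r`;
here `q = s⁴`, `q^{1/4} = s`, and `κ` plays the role of `q^D`. -/
noncomputable def Lp (R : Type*) [Ring R] [Algebra ℂ R] (s κ : Rˣ) (a astar : R)
    (r : Rˣ) : Matrix (Fin 2) (Fin 2) R :=
  (algebraMap ℂ R Complex.I * (↑r⁻¹ * ↑s⁻¹)) •
    (!![(1 : R), -(↑r ^ 2 * astar); -(↑r ^ 2 * a), 1 - ↑r ^ 4 * ↑s ^ 8 * ↑κ ^ 2] *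
      !![(↑κ : R), 0; 0, ↑κ⁻¹])

/-- The fused L-operator `L⁺_{{A,a},j}(x)` at `x = r²`, a 2×2 block matrix in the
auxiliary space (first index), blocks acting in the quantum space (second index). -/
noncomputable def fusedL (R : Type*) [Ring R] [Algebra ℂ R] (s κ : Rˣ) (a astar : R)
    (r : Rˣ) : Matrix (Fin 2 × Fin 2) (Fin 2 × Fin 2) R := fun p p' =>
  ![![((↑r : R) ^ 2 * ↑s ^ 4 - (↑r⁻¹ : R) ^ 2 * ↑s⁻¹ ^ 4) •
        (Lp R s κ a astar (r * s⁻¹ ^ 2) * !![((↑s⁻¹ : R) ^ 2), 0; 0, (↑s : R) ^ 2]),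
      (0 : Matrix (Fin 2) (Fin 2) R)],
    ![((↑s : R) ^ 4 - (↑s⁻¹ : R) ^ 4) •
        (Lp R s κ a astar (r * s ^ 2) * !![(0 : R), 1; 0, 0] *
          (((↑s : R) ^ 2 * (↑κ⁻¹ : R) ^ 2) • (1 : Matrix (Fin 2) (Fin 2) R))),
      ((↑r : R) ^ 2 - (↑r⁻¹ : R) ^ 2) •
        (Lp R s κ a astar (r * s ^ 2) * !![((↑s : R) ^ 2), 0; 0, (↑s⁻¹ : R) ^ 2])]]
    p.1 p'.1 p.2 p'.2

/-- Embed a matrix on `ℂ²_a ⊗ ℂ²_j` into `ℂ²_a ⊗ ℂ²_j ⊗ ℂ²_j̄` (identity on `j̄`). -/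
def embAJ (R : Type*) [Ring R] (M : Matrix (Fin 2 × Fin 2) (Fin 2 × Fin 2) R) :
    Matrix (Fin 2 × Fin 2 × Fin 2) (Fin 2 × Fin 2 × Fin 2) R := fun p p' =>
  if p.2.2 = p'.2.2 then M (p.1, p.2.1) (p'.1, p'.2.1) else 0

/-- Embed a matrix on `ℂ²_a ⊗ ℂ²_j̄` into `ℂ²_a ⊗ ℂ²_j ⊗ ℂ²_j̄` (identity on `j`). -/
def embAJbar (R : Type*) [Ring R] (M : Matrix (Fin 2 × Fin 2) (Fin 2 × Fin 2) R) :
    Matrix (Fin 2 × Fin 2 × Fin 2) (Fin 2 × Fin 2 × Fin 2) R := fun p p' =>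
  if p.2.1 = p'.2.1 then M (p.1, p.2.2) (p'.1, p'.2.2) else 0

/-- The flip `P_{j,j̄}` of the two quantum spaces, acting as identity on `a`. -/
def flipJJbar (R : Type*) [Ring R] :
    Matrix (Fin 2 × Fin 2 × Fin 2) (Fin 2 × Fin 2 × Fin 2) R := fun p p' =>
  if p.1 = p'.1 ∧ p.2.1 = p'.2.2 ∧ p.2.2 = p'.2.1 then 1 else 0

/-- The antisymmetrizer `𝒫⁻_{j,j̄} = ½(1 − P_{j,j̄})`. -/
noncomputable def antiSymJJbar (R : Type*) [Ring R] [Algebra ℂ R] :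
    Matrix (Fin 2 × Fin 2 × Fin 2) (Fin 2 × Fin 2 × Fin 2) R :=
  ((1 : ℂ) / 2) •
    ((1 : Matrix (Fin 2 × Fin 2 × Fin 2) (Fin 2 × Fin 2 × Fin 2) R) - flipJJbar R)

set_option linter.unusedSimpArgs false

theorem crossing_reduce (R : Type*) [Ring R] [Algebra ℂ R]
    (M N : Matrix (Fin 2 × Fin 2) (Fin 2 × Fin 2) R) (D : R)
    (h : ∀ α β c d : Fin 2,
      (M (α, 0) (0, c) * N (0, 1) (β, d) + M (α, 0) (1, c) * N (1, 1) (β, d)) -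
      (M (α, 1) (0, c) * N (0, 0) (β, d) + M (α, 1) (1, c) * N (1, 0) (β, d)) =
      if α = β then (if c = 0 ∧ d = 1 then D else if c = 1 ∧ d = 0 then -D else 0) else 0) :
    antiSymJJbar R * embAJ R M * embAJbar R N = D • antiSymJJbar R := by
  have e : D • antiSymJJbar R = ((1 : ℂ) / 2) •
      (D • ((1 : Matrix (Fin 2 × Fin 2 × Fin 2) (Fin 2 × Fin 2 × Fin 2) R) - flipJJbar R)) := by
    ext p q
    simp only [antiSymJJbar, Matrix.smul_apply, smul_eq_mul, mul_smul_comm]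
  rw [e, antiSymJJbar, smul_mul_assoc, smul_mul_assoc]
  congr 1
  have hF : (1 - flipJJbar R) * embAJ R M = Matrix.of (fun p q => embAJ R M p q
      - embAJ R M (p.1, p.2.2, p.2.1) q) := by
    rw [sub_mul, one_mul]
    ext ⟨p1, p2, p3⟩ q
    simp only [Matrix.sub_apply, Matrix.of_apply, Matrix.mul_apply, flipJJbar]
    congr 1
    rw [Finset.sum_eq_single (p1, p3, p2)]
    · simp
    · rintro ⟨b1, b2, b3⟩ - hb
      rw [if_neg, zero_mul]
      rintro ⟨h1, h2, h3⟩
      simp_all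
    · simp
  rw [hF]
  ext ⟨α, p2, p3⟩ ⟨β, c, d⟩
  have hh := h α β c d
  simp only [Matrix.mul_apply, Matrix.of_apply, embAJ, embAJbar, Fintype.sum_prod_type,
    Fin.sum_univ_two, Matrix.smul_apply, Matrix.sub_apply, Matrix.one_apply, flipJJbar,
    Prod.mk.injEq, smul_eq_mul]
  have hn := congrArg Neg.neg hh
  fin_cases p2 <;> fin_cases p3 <;> fin_cases c <;> fin_cases d <;> by_cases hab : α = β <;>
    simp [hab, sub_mul] at hh hn ⊢ <;>
    first
    | done
    | (rw [← hh]; abel1)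
    | (rw [← hn]; abel1)

theorem Lp_eq (R Z : Type*) [Ring R] [Algebra ℂ R] [CommRing Z] [Algebra Z R]
    (s κ r : Rˣ) (a astar : R) (S T X Y J : Z)
    (hS : (↑s : R) = S • (1 : R)) (hT : (↑s⁻¹ : R) = T • (1 : R))
    (hX : (↑r : R) = X • (1 : R)) (hY : (↑r⁻¹ : R) = Y • (1 : R))
    (hJ : algebraMap ℂ R Complex.I = J • (1 : R)) :
    Lp R s κ a astar r = !![(J * Y * T) • (↑κ : R), -((J * Y * T * X ^ 2) • (astar * ↑κ⁻¹));
      -((J * Y * T * X ^ 2) • (a * ↑κ)),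
      (J * Y * T) • (↑κ⁻¹ : R) - (J * Y * T * X ^ 4 * S ^ 8) • (↑κ : R)] := by
  have hk : (↑κ : R) ^ 2 * ↑κ⁻¹ = ↑κ := by rw [pow_two, mul_assoc, Units.mul_inv, mul_one]
  rw [Lp, hS, hT, hX, hY, hJ]
  ext i j
  fin_cases i <;> fin_cases j <;>
    simp [Matrix.mul_apply, Fin.sum_univ_two, smul_pow, smul_smul, sub_mul, smul_sub, hk] <;>
    module

theorem fusedL_eq (R Z : Type*) [Ring R] [Algebra ℂ R] [CommRing Z] [Algebra Z R]
    (s κ r : Rˣ) (a astar : R) (S T X Y J : Z)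
    (hS : (↑s : R) = S • (1 : R)) (hT : (↑s⁻¹ : R) = T • (1 : R))
    (hX : (↑r : R) = X • (1 : R)) (hY : (↑r⁻¹ : R) = Y • (1 : R))
    (hJ : algebraMap ℂ R Complex.I = J • (1 : R))
    (X₁ Y₁ X₂ Y₂ : Z) (hX₁ : X₁ = X * T ^ 2) (hY₁ : Y₁ = Y * S ^ 2)
    (hX₂ : X₂ = X * S ^ 2) (hY₂ : Y₂ = Y * T ^ 2)
    (C₁ C₂ C₃ : Z) (hC₁ : C₁ = X ^ 2 * S ^ 4 - Y ^ 2 * T ^ 4)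
    (hC₂ : C₂ = S ^ 4 - T ^ 4) (hC₃ : C₃ = X ^ 2 - Y ^ 2) :
    fusedL R s κ a astar r = fun p p' =>
      ![![!![(C₁ * (J * Y₁ * T) * T ^ 2) • (↑κ : R),
              (-(C₁ * (J * Y₁ * T * X₁ ^ 2) * S ^ 2)) • (astar * ↑κ⁻¹);
            (-(C₁ * (J * Y₁ * T * X₁ ^ 2) * T ^ 2)) • (a * ↑κ),
              (C₁ * (J * Y₁ * T) * S ^ 2) • (↑κ⁻¹ : R) -
              (C₁ * (J * Y₁ * T * X₁ ^ 4 * S ^ 8) * S ^ 2) • (↑κ : R)], 0],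
        ![!![0, (C₂ * (J * Y₂ * T) * S ^ 2) • (↑κ⁻¹ : R);
            0, (-(C₂ * (J * Y₂ * T * X₂ ^ 2) * S ^ 2)) • (a * ↑κ⁻¹)],
          !![(C₃ * (J * Y₂ * T) * S ^ 2) • (↑κ : R),
              (-(C₃ * (J * Y₂ * T * X₂ ^ 2) * T ^ 2)) • (astar * ↑κ⁻¹);
            (-(C₃ * (J * Y₂ * T * X₂ ^ 2) * S ^ 2)) • (a * ↑κ),
              (C₃ * (J * Y₂ * T) * T ^ 2) • (↑κ⁻¹ : R) -
              (C₃ * (J * Y₂ * T * X₂ ^ 4 * S ^ 8) * T ^ 2) • (↑κ : R)]]]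
      p.1 p'.1 p.2 p'.2 := by
  have hk : (↑κ : R) * (↑κ⁻¹) ^ 2 = ↑κ⁻¹ := by rw [pow_two, ← mul_assoc, Units.mul_inv, one_mul]
  have e1 := Lp_eq R Z s κ (r * s⁻¹ ^ 2) a astar S T X₁ Y₁ J hS hT
    (by rw [Units.val_mul, Units.val_pow_eq_pow_val, hX, hT, hX₁, smul_pow, one_pow,
      smul_mul_smul_comm, one_mul])
    (by rw [_root_.mul_inv_rev, inv_pow, inv_inv, Units.val_mul, Units.val_pow_eq_pow_val, hY, hS,
      hY₁, smul_pow, one_pow, smul_mul_smul_comm, one_mul, mul_comm Y]) hJ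
  have e2 := Lp_eq R Z s κ (r * s ^ 2) a astar S T X₂ Y₂ J hS hT
    (by rw [Units.val_mul, Units.val_pow_eq_pow_val, hX, hS, hX₂, smul_pow, one_pow,
      smul_mul_smul_comm, one_mul])
    (by rw [_root_.mul_inv_rev, ← inv_pow, Units.val_mul, Units.val_pow_eq_pow_val, hY, hT,
      hY₂, smul_pow, one_pow, smul_mul_smul_comm, one_mul, mul_comm Y]) hJ
  have c1 : (↑r : R) ^ 2 * ↑s ^ 4 - (↑r⁻¹ : R) ^ 2 * ↑s⁻¹ ^ 4 = C₁ • (1 : R) := by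
    rw [hC₁, hX, hY, hS, hT]
    simp only [smul_pow, one_pow, smul_mul_smul_comm, one_mul, sub_smul]
  have c2 : (↑s : R) ^ 4 - (↑s⁻¹ : R) ^ 4 = C₂ • (1 : R) := by
    rw [hC₂, hS, hT]
    simp only [smul_pow, one_pow, sub_smul]
  have c3 : (↑r : R) ^ 2 - (↑r⁻¹ : R) ^ 2 = C₃ • (1 : R) := by
    rw [hC₃, hX, hY]
    simp only [smul_pow, one_pow, sub_smul]
  ext ⟨p1, p2⟩ ⟨q1, q2⟩
  have hone : ∀ c : R, c • (1 : Matrix (Fin 2) (Fin 2) R) = !![c, 0; 0, c] := by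
    intro c
    ext i j
    fin_cases i <;> fin_cases j <;> simp
  rw [fusedL, e1, e2, c1, c2, c3, hS, hT, hone]
  clear hC₁ hC₂ hC₃ hX₁ hX₂ hY₁ hY₂ e1 e2 c1 c2 c3
  fin_cases p1 <;> fin_cases q1 <;> fin_cases p2 <;> fin_cases q2 <;>
    simp [Matrix.mul_apply, Fin.sum_univ_two, smul_pow, smul_smul, smul_sub, hk, mul_assoc] <;>
    module

set_option maxHeartbeats 4000000 in
theorem crossing_aux (R Z : Type*) [Ring R] [Algebra ℂ R] [CommRing Z] [Algebra Z R]
    (s w κ : Rˣ) (a astar : R) (S T W V J : Z)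
    (hS : (↑s : R) = S • (1 : R)) (hT : (↑s⁻¹ : R) = T • (1 : R))
    (hW : (↑w : R) = W • (1 : R)) (hV : (↑w⁻¹ : R) = V • (1 : R))
    (hJ : algebraMap ℂ R Complex.I = J • (1 : R))
    (hST : S * T = 1) (hWV : W * V = 1) (hJJ : J * J = -1)
    (h1 : ↑κ * astar = ↑s ^ 4 * (astar * ↑κ))
    (h2 : ↑κ * a = ↑s⁻¹ ^ 4 * (a * ↑κ))
    (h3 : astar * a = 1 - ↑κ ^ 2)
    (h4 : a * astar = 1 - ↑s ^ 8 * ↑κ ^ 2) :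
    antiSymJJbar R * embAJ R (fusedL R s κ a astar (w * s⁻¹ ^ 2)) *
        embAJbar R (fusedL R s κ a astar w) =
      (((↑w : R) ^ 2 * ↑s ^ 4 - (↑w⁻¹ : R) ^ 2 * ↑s⁻¹ ^ 4) *
          ((↑w : R) ^ 2 - (↑w⁻¹ : R) ^ 2) *
          ((↑w : R) ^ 2 * ↑s⁻¹ ^ 4 - (↑w⁻¹ : R) ^ 2 * ↑s ^ 4)) •
        antiSymJJbar R := by
  have hw' : (↑(w * s⁻¹ ^ 2) : R) = (W * T ^ 2) • (1 : R) := by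
    rw [Units.val_mul, Units.val_pow_eq_pow_val, hW, hT, smul_pow, one_pow,
      smul_mul_smul_comm, one_mul]
  have hv' : (↑(w * s⁻¹ ^ 2)⁻¹ : R) = (V * S ^ 2) • (1 : R) := by
    rw [_root_.mul_inv_rev, inv_pow, inv_inv, Units.val_mul, Units.val_pow_eq_pow_val, hV, hS,
      smul_pow, one_pow, smul_mul_smul_comm, one_mul, mul_comm V]
  rw [fusedL_eq R Z s κ (w * s⁻¹ ^ 2) a astar S T (W * T ^ 2) (V * S ^ 2) J hS hT hw' hv' hJ
      (W * T ^ 4) (V * S ^ 4) W V (by ring) (by ring) (by linear_combination (-W * (S * T + 1)) * hST)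
      (by linear_combination (-V * (S * T + 1)) * hST)
      (W ^ 2 - V ^ 2) (S ^ 4 - T ^ 4) (W ^ 2 * T ^ 4 - V ^ 2 * S ^ 4)
      (by grind) rfl (by ring),
    fusedL_eq R Z s κ w a astar S T W V J hS hT hW hV hJ
      (W * T ^ 2) (V * S ^ 2) (W * S ^ 2) (V * T ^ 2) rfl rfl rfl rfl
      (W ^ 2 * S ^ 4 - V ^ 2 * T ^ 4) (S ^ 4 - T ^ 4) (W ^ 2 - V ^ 2) rfl rfl rfl]
  apply crossing_reduce
  have hD : ((↑w : R) ^ 2 * ↑s ^ 4 - (↑w⁻¹ : R) ^ 2 * ↑s⁻¹ ^ 4) *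
          ((↑w : R) ^ 2 - (↑w⁻¹ : R) ^ 2) *
          ((↑w : R) ^ 2 * ↑s⁻¹ ^ 4 - (↑w⁻¹ : R) ^ 2 * ↑s ^ 4) =
      ((W ^ 2 * S ^ 4 - V ^ 2 * T ^ 4) * (W ^ 2 - V ^ 2) * (W ^ 2 * T ^ 4 - V ^ 2 * S ^ 4)) •
        (1 : R) := by
    rw [hW, hV, hS, hT]
    simp only [smul_pow, one_pow, smul_mul_smul_comm, one_mul, ← sub_smul]
  rw [hD]
  have hkK : (↑κ⁻¹ : R) * ↑κ = 1 := by simp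
  have hKk : (↑κ : R) * ↑κ⁻¹ = 1 := by simp
  simp only [hS, hT, smul_pow, one_pow, smul_mul_assoc, one_mul] at h1 h2 h4
  clear hD hS hT hW hV hJ hw' hv'
  generalize (↑κ⁻¹ : R) = k at *
  generalize (↑κ : R) = K at *
  have h5 : k * astar = T ^ 4 • (astar * k) := by
    have : k * (K * astar) * k = k * (S ^ 4 • (astar * K)) * k := by rw [h1]
    rw [← mul_assoc, hkK, one_mul, mul_smul_comm, smul_mul_assoc, mul_assoc, mul_assoc, hKk,
      mul_one] at this
    rw [this, smul_smul, ← mul_pow, mul_comm T, hST, one_pow, one_smul]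
  have h6 : k * a = S ^ 4 • (a * k) := by
    have : k * (K * a) * k = k * (T ^ 4 • (a * K)) * k := by rw [h2]
    rw [← mul_assoc, hkK, one_mul, mul_smul_comm, smul_mul_assoc, mul_assoc, mul_assoc, hKk,
      mul_one] at this
    rw [this, smul_smul, ← mul_pow, hST, one_pow, one_smul]
  rw [pow_two] at h3 h4
  have assoc : ∀ {x y z : R}, x * y = z → ∀ u, x * (y * u) = z * u := by
    rintro x y z rfl u; rw [mul_assoc]
  have h1' := assoc h1
  have h2' := assoc h2
  have h3' := assoc h3
  have h4' := assoc h4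
  have h5' := assoc h5
  have h6' := assoc h6
  have h7' := assoc hkK
  have h8' := assoc hKk
  clear assoc
  intro α β c d
  fin_cases α <;> fin_cases β <;> fin_cases c <;> fin_cases d <;>
    simp [-mul_eq_zero] <;>
    simp only [mul_assoc, smul_mul_assoc, mul_smul_comm, one_mul, mul_one,
      smul_smul, mul_sub, sub_mul, mul_neg, neg_mul, smul_sub, smul_add, smul_neg,
      h1, h2, h3, h4, h5, h6, hkK, hKk, h1', h2', h3', h4', h5', h6', h7', h8'] <;>
    clear h1 h2 h3 h4 h5 h6 hkK hKk h1' h2' h3' h4' h5' h6' h7' h8' <;>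
    match_scalars <;> grind

/-- Crossing relation for the fused L-operator:
`𝒫⁻_{j,j̄} ⬝ L⁺_{{A,a},j}(ζq⁻¹) ⬝ L⁺_{{A,a},j̄}(ζ)
  = (ζq − ζ⁻¹q⁻¹)(ζ − ζ⁻¹)(ζq⁻¹ − ζ⁻¹q) 𝒫⁻_{j,j̄}`,
with `ζ = w²`, `(ζq⁻¹)^{1/2} = w s⁻²`. -/
theorem fused_crossing (R : Type*) [Ring R] [Algebra ℂ R] (s w κ : Rˣ) (a astar : R)
    (hs : ∀ x : R, ↑s * x = x * ↑s)
    (hw : ∀ x : R, ↑w * x = x * ↑w)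
    (h1 : ↑κ * astar = ↑s ^ 4 * (astar * ↑κ))
    (h2 : ↑κ * a = ↑s⁻¹ ^ 4 * (a * ↑κ))
    (h3 : astar * a = 1 - ↑κ ^ 2)
    (h4 : a * astar = 1 - ↑s ^ 8 * ↑κ ^ 2) :
    antiSymJJbar R * embAJ R (fusedL R s κ a astar (w * s⁻¹ ^ 2)) *
        embAJbar R (fusedL R s κ a astar w) =
      (((↑w : R) ^ 2 * ↑s ^ 4 - (↑w⁻¹ : R) ^ 2 * ↑s⁻¹ ^ 4) *
          ((↑w : R) ^ 2 - (↑w⁻¹ : R) ^ 2) *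
          ((↑w : R) ^ 2 * ↑s⁻¹ ^ 4 - (↑w⁻¹ : R) ^ 2 * ↑s ^ 4)) •
        antiSymJJbar R := by
  let _ : Algebra (Subring.center R) R := (Subring.center R).subtype.toAlgebra'
    (fun c x => ((Subring.mem_center_iff.mp c.2) x).symm)
  have sm : ∀ (c : Subring.center R), c • (1 : R) = (c : R) := fun c => by
    rw [← Algebra.algebraMap_eq_smul_one]; rfl
  have inv : ∀ u : Rˣ, (∀ x : R, ↑u * x = x * ↑u) → ∀ x : R, ↑u⁻¹ * x = x * ↑u⁻¹ := by
    intro u hu x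
    rw [Units.inv_mul_eq_iff_eq_mul, ← mul_assoc, hu, Units.mul_inv_cancel_right]
  have mem : ∀ c : R, (∀ x : R, c * x = x * c) → c ∈ Subring.center R := fun c hc =>
    Subring.mem_center_iff.mpr (fun x => (hc x).symm)
  refine crossing_aux R (Subring.center R) s w κ a astar
    ⟨↑s, mem _ hs⟩ ⟨↑s⁻¹, mem _ (inv s hs)⟩ ⟨↑w, mem _ hw⟩ ⟨↑w⁻¹, mem _ (inv w hw)⟩
    ⟨algebraMap ℂ R Complex.I, mem _ (fun x => Algebra.commutes _ x)⟩
    (by rw [sm]) (by rw [sm]) (by rw [sm]) (by rw [sm]) (by rw [sm]) ?_ ?_ ?_ h1 h2 h3 h4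
  · ext; simp
  · ext; simp
  · ext
    change algebraMap ℂ R Complex.I * algebraMap ℂ R Complex.I = -1
    rw [← map_mul, Complex.I_mul_I, map_neg, map_one]
end

section
/- Factorization identity used in the proof of the reduction relations (eq. (exp2) of the paper): as 8×8 matrices over R acting on ℂ²_a ⊗ ℂ²_k ⊗ ℂ²_{k̄}, 2𝒫⁻_{k,k̄} · L⁺_{{A,a},k}(ζ) · σ⁺_a · L⁺_{{A,a},k̄}(ζq⁻¹) = diag_a(ζq − ζ⁻¹q⁻¹, (q − q⁻¹) q^{−1/2} κ⁻²) · (2𝒫⁻_{k,k̄} L⁺_{A,k}(ζq⁻¹) L⁺_{A,k̄}(ζ)) · [[q^{−σ³_k/2} σ⁺_{k̄}, q^{(σ³_{k̄} − σ³_k)/2}],[σ⁺_k σ⁺_{k̄}, σ⁺_k q^{σ³_{k̄}/2}]]_a · diag_a((q − q⁻¹) q^{1/2} κ⁻², ζq⁻¹ − ζ⁻¹q), where 𝒫⁻_{k,k̄} := ½(1 − P_{k,k̄}) is the antisymmetrizer of the spaces k, k̄, σ⁺_a is σ⁺ acting in space a, subscripts k, k̄ indicate in which quantum space a 2×2 matrix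 acts, the middle factor in square brackets is a 2×2 matrix in space a whose entries are matrices acting on k ⊗ k̄, and the diag_a factors are diagonal 2×2 matrices in space a with the indicated R-valued scalar entries. -/
open Matrix Kronecker

/-- Embed a matrix on `ℂ²_a ⊗ ℂ²_k` into `ℂ²_a ⊗ ℂ²_k ⊗ ℂ²_k̄` (identity on `k̄`). -/
def embAK (R : Type*) [Ring R] (M : Matrix (Fin 2 × Fin 2) (Fin 2 × Fin 2) R) :
    Matrix (Fin 2 × Fin 2 × Fin 2) (Fin 2 × Fin 2 × Fin 2) R := fun p p' =>
  if p.2.2 = p'.2.2 then M (p.1, p.2.1) (p'.1, p'.2.1) else 0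

/-- Embed a matrix on `ℂ²_a ⊗ ℂ²_k̄` into `ℂ²_a ⊗ ℂ²_k ⊗ ℂ²_k̄` (identity on `k`). -/
def embAKbar (R : Type*) [Ring R] (M : Matrix (Fin 2 × Fin 2) (Fin 2 × Fin 2) R) :
    Matrix (Fin 2 × Fin 2 × Fin 2) (Fin 2 × Fin 2 × Fin 2) R := fun p p' =>
  if p.2.1 = p'.2.1 then M (p.1, p.2.2) (p'.1, p'.2.2) else 0

/-- The flip `P_{k,k̄}` of the two quantum spaces, acting as identity on `a`. -/
def flipKKbar (R : Type*) [Ring R] :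
    Matrix (Fin 2 × Fin 2 × Fin 2) (Fin 2 × Fin 2 × Fin 2) R := fun p p' =>
  if p.1 = p'.1 ∧ p.2.1 = p'.2.2 ∧ p.2.2 = p'.2.1 then 1 else 0

/-- The antisymmetrizer `𝒫⁻_{k,k̄} = ½(1 − P_{k,k̄})`. -/
noncomputable def antiSymKKbar (R : Type*) [Ring R] [Algebra ℂ R] :
    Matrix (Fin 2 × Fin 2 × Fin 2) (Fin 2 × Fin 2 × Fin 2) R :=
  ((1 : ℂ) / 2) •
    ((1 : Matrix (Fin 2 × Fin 2 × Fin 2) (Fin 2 × Fin 2 × Fin 2) R) - flipKKbar R)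

/-- `σ⁺` acting in the auxiliary space `a` (identity on `k`, `k̄`). -/
def sigmaPlusA (R : Type*) [Ring R] :
    Matrix (Fin 2 × Fin 2 × Fin 2) (Fin 2 × Fin 2 × Fin 2) R := fun p p' =>
  if p.2 = p'.2 then !![(0 : R), 1; 0, 0] p.1 p'.1 else 0

/-- `L⁺_{A,k}(x)` at `x = r²`: the operator `L⁺(x)` acting in space `k`
(identity on `a` and `k̄`). -/
noncomputable def LAk (R : Type*) [Ring R] [Algebra ℂ R] (s κ : Rˣ) (a astar : R)
    (r : Rˣ) : Matrix (Fin 2 × Fin 2 × Fin 2) (Fin 2 × Fin 2 × Fin 2) R := fun p p' =>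
  if p.1 = p'.1 ∧ p.2.2 = p'.2.2 then Lp R s κ a astar r p.2.1 p'.2.1 else 0

/-- `L⁺_{A,k̄}(x)` at `x = r²`: the operator `L⁺(x)` acting in space `k̄`
(identity on `a` and `k`). -/
noncomputable def LAkbar (R : Type*) [Ring R] [Algebra ℂ R] (s κ : Rˣ) (a astar : R)
    (r : Rˣ) : Matrix (Fin 2 × Fin 2 × Fin 2) (Fin 2 × Fin 2 × Fin 2) R := fun p p' =>
  if p.1 = p'.1 ∧ p.2.1 = p'.2.1 then Lp R s κ a astar r p.2.2 p'.2.2 else 0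

/-- A diagonal 2×2 matrix in the auxiliary space `a` with `R`-valued entries `c0`, `c1`
(identity on `k`, `k̄`). -/
def diagAux (R : Type*) [Ring R] (c0 c1 : R) :
    Matrix (Fin 2 × Fin 2 × Fin 2) (Fin 2 × Fin 2 × Fin 2) R := fun p p' =>
  if p = p' then (if p.1 = 0 then c0 else c1) else 0

/-- The middle 2×2 matrix in space `a` whose entries are the operators
`[[q^{−σ³_k/2} σ⁺_{k̄}, q^{(σ³_{k̄}−σ³_k)/2}],[σ⁺_k σ⁺_{k̄}, σ⁺_k q^{σ³_{k̄}/2}]]`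
acting on `k ⊗ k̄`. -/
noncomputable def midMat (R : Type*) [Ring R] [Algebra ℂ R] (s : Rˣ) :
    Matrix (Fin 2 × Fin 2 × Fin 2) (Fin 2 × Fin 2 × Fin 2) R := fun p p' =>
  ![![!![((↑s⁻¹ : R) ^ 2), 0; 0, (↑s : R) ^ 2] ⊗ₖ !![(0 : R), 1; 0, 0],
      !![((↑s⁻¹ : R) ^ 2), 0; 0, (↑s : R) ^ 2] ⊗ₖ !![((↑s : R) ^ 2), 0; 0, (↑s⁻¹ : R) ^ 2]],
    ![!![(0 : R), 1; 0, 0] ⊗ₖ !![(0 : R), 1; 0, 0],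
      !![(0 : R), 1; 0, 0] ⊗ₖ !![((↑s : R) ^ 2), 0; 0, (↑s⁻¹ : R) ^ 2]]]
    p.1 p'.1 p.2 p'.2

theorem lhs_entry (R : Type*) [Ring R] (M N : Matrix (Fin 2 × Fin 2) (Fin 2 × Fin 2) R)
    (i j l i' j' l' : Fin 2) :
    (embAK R M * sigmaPlusA R * embAKbar R N) (i, j, l) (i', j', l') =
      M (i, j) (0, j') * N (1, l) (i', l') := by
  simp only [Matrix.mul_apply, Fintype.sum_prod_type, embAK, sigmaPlusA, embAKbar,
    Fin.sum_univ_two]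
  fin_cases l <;> fin_cases j' <;> simp

theorem LL_entry (R : Type*) [Ring R] [Algebra ℂ R] (s κ : Rˣ) (a astar : R) (r r' : Rˣ)
    (i j l i' j' l' : Fin 2) :
    (LAk R s κ a astar r * LAkbar R s κ a astar r') (i, j, l) (i', j', l') =
      if i = i' then Lp R s κ a astar r j j' * Lp R s κ a astar r' l l' else 0 := by
  simp only [Matrix.mul_apply, Fintype.sum_prod_type, LAk, LAkbar, Fin.sum_univ_two]
  fin_cases i <;> fin_cases i' <;> fin_cases l <;> fin_cases j' <;> simp

theorem diag_mul_entry (R : Type*) [Ring R] (c0 c1 : R)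
    (M : Matrix (Fin 2 × Fin 2 × Fin 2) (Fin 2 × Fin 2 × Fin 2) R)
    (p p' : Fin 2 × Fin 2 × Fin 2) :
    (diagAux R c0 c1 * M) p p' = (if p.1 = 0 then c0 else c1) * M p p' := by
  simp [Matrix.mul_apply, diagAux]

theorem mul_diag_entry (R : Type*) [Ring R] (c0 c1 : R)
    (M : Matrix (Fin 2 × Fin 2 × Fin 2) (Fin 2 × Fin 2 × Fin 2) R)
    (p p' : Fin 2 × Fin 2 × Fin 2) :
    (M * diagAux R c0 c1) p p' = M p p' * (if p'.1 = 0 then c0 else c1) := by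
  simp [Matrix.mul_apply, diagAux]

theorem anti_eq (R : Type*) [Ring R] [Algebra ℂ R] :
    (2 : ℂ) • antiSymKKbar R = 1 - flipKKbar R := by
  simp [antiSymKKbar, smul_smul]

theorem diag_anti (R : Type*) [Ring R] [Algebra ℂ R] (c0 c1 : R) :
    diagAux R c0 c1 * ((2 : ℂ) • antiSymKKbar R) =
      ((2 : ℂ) • antiSymKKbar R) * diagAux R c0 c1 := by
  rw [anti_eq]
  ext p p'
  rw [diag_mul_entry, mul_diag_entry]
  by_cases h : p.1 = p'.1
  · rw [h]
    simp only [Matrix.sub_apply, Matrix.one_apply, flipKKbar]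
    split_ifs <;> simp
  · have h' : p ≠ p' := fun e => h (by rw [e])
    simp [flipKKbar, h, h']

theorem units_central (R : Type*) [Ring R] (s : Rˣ) (hs : ∀ x : R, ↑s * x = x * ↑s) (x : R) :
    (↑s⁻¹ : R) * x = x * ↑s⁻¹ := by
  have : Commute (↑s : R) x := hs x
  exact this.units_inv_left

theorem rearr3 (R : Type*) [Ring R] (k c m S c' m' : R) (h : c = S * c')
    (hc : ∀ z, c * z = z * c) (hm : k * m = m' * k) :
    k * (c * m) = S * (c' * m' * k) := by
  rw [← mul_assoc, ← hc, mul_assoc, hm, h]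
  simp only [mul_assoc]

theorem key (R : Type*) [Ring R] [Algebra ℂ R] (s w κ : Rˣ) (a astar : R)
    (hs : ∀ x : R, ↑s * x = x * ↑s)
    (hw : ∀ x : R, ↑w * x = x * ↑w)
    (h2 : ↑κ * a = ↑s⁻¹ ^ 4 * (a * ↑κ)) (i : Fin 2) :
    (↑κ⁻¹ : R) ^ 2 * Lp R s κ a astar (w * s⁻¹ ^ 2) i 0 =
      (↑s : R) ^ 4 * (Lp R s κ a astar (w * s ^ 2) i 0 * (↑κ⁻¹ : R) ^ 2) := by
  have hI : ∀ x : R, x * algebraMap ℂ R Complex.I = algebraMap ℂ R Complex.I * x :=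
    fun x => (Algebra.commutes _ x).symm
  have hs' : ∀ x : R, (↑s⁻¹ : R) * x = x * ↑s⁻¹ := units_central R s hs
  have hw' : ∀ x : R, (↑w⁻¹ : R) * x = x * ↑w⁻¹ := units_central R w hw
  have hk : (↑κ⁻¹ : R) * a = ↑s ^ 4 * (a * ↑κ⁻¹) := by
    rw [Units.inv_mul_eq_iff_eq_mul]
    have e : (↑s : R) ^ 4 * ↑s⁻¹ ^ 4 = 1 := by
      rw [← Units.val_pow_eq_pow_val, ← Units.val_pow_eq_pow_val, ← Units.val_mul]; simp
    have c : (↑κ : R) * ↑s ^ 4 = ↑s ^ 4 * ↑κ :=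
      ((show Commute (↑s : R) ↑κ from hs _).pow_left 4).symm
    rw [← mul_assoc, c, mul_assoc, ← mul_assoc (κ : R), h2, mul_assoc, mul_assoc, Units.mul_inv,
      mul_one, ← mul_assoc, e, one_mul]
  have s4 : ∀ x : R, ↑s ^ 4 * x = x * ↑s ^ 4 := fun x =>
    (show Commute (↑s : R) x from hs x).pow_left 4
  have hk2 : (↑κ⁻¹ : R) ^ 2 * a = ↑s ^ 4 * ↑s ^ 4 * (a * ↑κ⁻¹ ^ 2) := by
    rw [pow_two, mul_assoc, hk, ← mul_assoc, ← s4, mul_assoc, ← mul_assoc _ a, hk]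
    simp only [mul_assoc]
  have kk : (↑κ : R) * ↑κ⁻¹ ^ 2 = ↑κ⁻¹ := by rw [pow_two, ← mul_assoc]; simp
  have kk' : (↑κ⁻¹ : R) ^ 2 * ↑κ = ↑κ⁻¹ := by rw [pow_two, mul_assoc]; simp
  have es : w * s ^ 2 = w * s⁻¹ ^ 2 * s ^ 4 := by
    rw [mul_assoc]; congr 1; group
  have hr : ∀ x : R, (↑(w * s⁻¹ ^ 2) : R) * x = x * ↑(w * s⁻¹ ^ 2) := fun x => by
    have c1 : Commute (↑w : R) x := hw x
    have c2 : Commute (↑s⁻¹ : R) x := hs' x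
    push_cast
    exact c1.mul_left (c2.pow_left 2)
  rw [es]
  generalize w * s⁻¹ ^ 2 = r at *
  have hr' : ∀ x : R, (↑r⁻¹ : R) * x = x * ↑r⁻¹ := units_central R r hr
  have ec : (↑r⁻¹ : R) = ↑s ^ 4 * ↑(r * s ^ 4)⁻¹ := by
    rw [← Units.val_pow_eq_pow_val, ← Units.val_mul]; congr 1; group
  have cc : ∀ x : R, algebraMap ℂ R Complex.I * (↑r⁻¹ * ↑s⁻¹) * x =
      x * (algebraMap ℂ R Complex.I * (↑r⁻¹ * ↑s⁻¹)) := fun x =>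
    (show Commute (algebraMap ℂ R Complex.I) x from (hI x).symm).mul_left
      ((show Commute (↑r⁻¹ : R) x from hr' x).mul_left (show Commute (↑s⁻¹ : R) x from hs' x))
  have e3 : algebraMap ℂ R Complex.I * (↑r⁻¹ * ↑s⁻¹) =
      ↑s ^ 4 * (algebraMap ℂ R Complex.I * (↑(r * s ^ 4)⁻¹ * ↑s⁻¹)) := by
    rw [ec, ← mul_assoc (↑s ^ 4 : R), s4 (algebraMap ℂ R Complex.I)]
    simp only [mul_assoc]
  have e4 : (↑(r * s ^ 4) : R) ^ 2 = ↑r ^ 2 * (↑s ^ 4 * ↑s ^ 4) := by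
    rw [Units.val_mul, Units.val_pow_eq_pow_val, Commute.mul_pow (hr _), pow_two (↑s ^ 4 : R)]
  have r2 : ∀ x : R, ↑r ^ 2 * x = x * ↑r ^ 2 := fun x =>
    (show Commute (↑r : R) x from hr x).pow_left 2
  simp only [Lp, Matrix.smul_apply, smul_eq_mul]
  refine rearr3 R _ _ _ _ _ _ e3 cc ?_
  rw [e4]
  fin_cases i
  · simp [Matrix.mul_apply, kk, kk']
  · simp only [Matrix.mul_apply, Fin.sum_univ_two]
    simp
    have e5 : (↑κ⁻¹ : R) ^ 2 * (↑r ^ 2 * a * ↑κ) = ↑r ^ 2 * ((↑κ⁻¹ ^ 2 * a) * ↑κ) := by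
      rw [mul_assoc, ← mul_assoc, ← r2]
      simp only [mul_assoc]
    rw [e5, hk2]
    simp only [mul_assoc, kk, kk']

theorem rearr1 (R : Type*) [Ring R] (A x u B y v : R) (hB : ∀ z, B * z = z * B)
    (hu : ∀ z, u * z = z * u) :
    A * (x * u) * (B * (y * v)) = A * (x * y) * u * (B * v) := by
  rw [← mul_assoc B, hB y]
  simp only [mul_assoc]
  rw [← mul_assoc u y, hu y]
  simp only [mul_assoc]

theorem rearr2 (R : Type*) [Ring R] (A x u C y v : R) (hC : ∀ z, C * z = z * C)
    (hu : ∀ z, u * z = z * u) :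
    A * (x * u) * (C * (y * v)) = A * (x * y) * (u * v) * C := by
  rw [hC]
  simp only [mul_assoc]
  rw [← mul_assoc u y, hu y]
  simp only [mul_assoc]

/-- Factorization identity (eq. (exp2) of the paper): on `ℂ²_a ⊗ ℂ²_k ⊗ ℂ²_k̄`,
`2𝒫⁻_{k,k̄} L⁺_{{A,a},k}(ζ) σ⁺_a L⁺_{{A,a},k̄}(ζq⁻¹)
 = diag_a(ζq − ζ⁻¹q⁻¹, (q − q⁻¹)q^{−1/2}κ⁻²) ⬝ (2𝒫⁻_{k,k̄} L⁺_{A,k}(ζq⁻¹) L⁺_{A,k̄}(ζ)) ⬝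
   [[q^{−σ³_k/2}σ⁺_{k̄}, q^{(σ³_{k̄}−σ³_k)/2}],[σ⁺_kσ⁺_{k̄}, σ⁺_k q^{σ³_{k̄}/2}]]_a ⬝
   diag_a((q − q⁻¹)q^{1/2}κ⁻², ζq⁻¹ − ζ⁻¹q)`,
with `ζ = w²`, `(ζq^{±1})^{1/2} = w s^{±2}`. -/
theorem factorization_exp2 (R : Type*) [Ring R] [Algebra ℂ R] (s w κ : Rˣ) (a astar : R)
    (hs : ∀ x : R, ↑s * x = x * ↑s)
    (hw : ∀ x : R, ↑w * x = x * ↑w)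
    (h1 : ↑κ * astar = ↑s ^ 4 * (astar * ↑κ))
    (h2 : ↑κ * a = ↑s⁻¹ ^ 4 * (a * ↑κ))
    (h3 : astar * a = 1 - ↑κ ^ 2)
    (h4 : a * astar = 1 - ↑s ^ 8 * ↑κ ^ 2) :
    (2 : ℂ) • antiSymKKbar R * embAK R (fusedL R s κ a astar w) * sigmaPlusA R *
        embAKbar R (fusedL R s κ a astar (w * s⁻¹ ^ 2)) =
      diagAux R ((↑w : R) ^ 2 * ↑s ^ 4 - (↑w⁻¹ : R) ^ 2 * ↑s⁻¹ ^ 4)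
          (((↑s : R) ^ 4 - (↑s⁻¹ : R) ^ 4) * ((↑s⁻¹ : R) ^ 2 * (↑κ⁻¹ : R) ^ 2)) *
        ((2 : ℂ) • antiSymKKbar R * LAk R s κ a astar (w * s⁻¹ ^ 2) *
          LAkbar R s κ a astar w) *
        midMat R s *
        diagAux R (((↑s : R) ^ 4 - (↑s⁻¹ : R) ^ 4) * ((↑s : R) ^ 2 * (↑κ⁻¹ : R) ^ 2))
          ((↑w : R) ^ 2 * ↑s⁻¹ ^ 4 - (↑w⁻¹ : R) ^ 2 * ↑s ^ 4) := by
  have hs' : ∀ x : R, (↑s⁻¹ : R) * x = x * ↑s⁻¹ := units_central R s hs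
  have hw' : ∀ x : R, (↑w⁻¹ : R) * x = x * ↑w⁻¹ := units_central R w hw
  have hwSq : ∀ x : R, (↑w⁻¹ : R) ^ 2 * x = x * ↑w⁻¹ ^ 2 := fun x =>
    (show Commute (↑w⁻¹ : R) x from hw' x).pow_left 2
  have K := key R s w κ a astar hs hw h2
  rw [mul_assoc ((2 : ℂ) • antiSymKKbar R), ← mul_assoc (diagAux R _ _),
    ← mul_assoc (diagAux R _ _), diag_anti]
  simp only [mul_assoc ((2 : ℂ) • antiSymKKbar R)]
  congr 1
  ext ⟨i, j, l⟩ ⟨i', j', l'⟩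
  rw [lhs_entry, mul_diag_entry, Matrix.mul_apply]
  simp only [mul_assoc (diagAux R _ _), diag_mul_entry, LL_entry, Fintype.sum_prod_type]
  have e1 : w * s⁻¹ ^ 2 * s ^ 2 = w := by simp
  have e2 : (↑(w * s⁻¹ ^ 2) : R) ^ 2 - (↑(w * s⁻¹ ^ 2)⁻¹ : R) ^ 2 =
      (↑w : R) ^ 2 * ↑s⁻¹ ^ 4 - (↑w⁻¹ : R) ^ 2 * ↑s ^ 4 := by
    have c1 : Commute (↑w : R) (↑s⁻¹ ^ 2) := hw _
    have c2 : Commute (↑s ^ 2 : R) (↑w⁻¹) := ((hw' _).symm)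
    have e : (w * s⁻¹ ^ 2)⁻¹ = s ^ 2 * w⁻¹ := by group
    rw [e]
    push_cast
    rw [c1.mul_pow, c2.mul_pow, ← pow_mul, ← pow_mul]
    congr 1
    exact (hwSq _).symm
  simp only [fusedL, e1, e2]
  have S : ∀ (n : ℕ) (x : R), ↑s ^ n * x = x * ↑s ^ n := fun n x =>
    (show Commute (↑s : R) x from hs x).pow_left n
  have Sinv : ∀ (n : ℕ) (x : R), ↑s⁻¹ ^ n * x = x * ↑s⁻¹ ^ n := fun n x =>
    (show Commute (↑s⁻¹ : R) x from hs' x).pow_left n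
  have W : ∀ (n : ℕ) (x : R), ↑w ^ n * x = x * ↑w ^ n := fun n x =>
    (show Commute (↑w : R) x from hw x).pow_left n
  have cB : ∀ x : R, ((↑s : R) ^ 4 - (↑s⁻¹ : R) ^ 4) * x = x * (↑s ^ 4 - ↑s⁻¹ ^ 4) := fun x => by
    rw [sub_mul, mul_sub, S, Sinv]
  have cC : ∀ x : R, ((↑w : R) ^ 2 * ↑s⁻¹ ^ 4 - (↑w⁻¹ : R) ^ 2 * ↑s ^ 4) * x =
      x * (↑w ^ 2 * ↑s⁻¹ ^ 4 - ↑w⁻¹ ^ 2 * ↑s ^ 4) := fun x => by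
    rw [sub_mul, mul_sub, mul_assoc, mul_assoc, S, Sinv, ← mul_assoc, ← mul_assoc, W, hwSq]
    simp only [mul_assoc]
  generalize hA : (↑w : R) ^ 2 * ↑s ^ 4 - (↑w⁻¹ : R) ^ 2 * ↑s⁻¹ ^ 4 = A
  generalize hB : (↑s : R) ^ 4 - (↑s⁻¹ : R) ^ 4 = B
  generalize hC : (↑w : R) ^ 2 * ↑s⁻¹ ^ 4 - (↑w⁻¹ : R) ^ 2 * ↑s ^ 4 = C
  generalize Lp R s κ a astar (w * s⁻¹ ^ 2) = L1 at *
  generalize Lp R s κ a astar (w * s ^ 2) = L3 at *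
  generalize Lp R s κ a astar w = L2 at *
  simp only [hB] at cB
  simp only [hC] at cC
  have K' : ∀ i, L3 i 0 * (↑s ^ 2 * ↑κ⁻¹ ^ 2) = ↑s⁻¹ ^ 2 * ↑κ⁻¹ ^ 2 * L1 i 0 := fun i => by
    have e : (↑s⁻¹ : R) ^ 2 * ↑s ^ 4 = ↑s ^ 2 := by
      rw [← Units.val_pow_eq_pow_val, ← Units.val_pow_eq_pow_val, ← Units.val_mul,
        ← Units.val_pow_eq_pow_val]
      congr 1
      group
    rw [mul_assoc, K, ← mul_assoc (↑s⁻¹ ^ 2 : R), e, ← mul_assoc, ← S, mul_assoc]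
  fin_cases i <;> fin_cases i' <;> fin_cases j' <;> fin_cases l' <;>
    simp [Matrix.mul_apply, midMat, Fin.sum_univ_two, Matrix.kroneckerMap_apply]
  · exact rearr1 R _ _ _ _ _ _ cB (Sinv 2)
  · exact rearr1 R _ _ _ _ _ _ cB (S 2)
  · exact rearr2 R _ _ _ _ _ _ cC (Sinv 2)
  · exact rearr2 R _ _ _ _ _ _ cC (Sinv 2)
  · exact rearr2 R _ _ _ _ _ _ cC (S 2)
  · exact rearr2 R _ _ _ _ _ _ cC (S 2)
  · rw [K', ← mul_assoc B (L2 l 0), cB (L2 l 0)]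
    simp only [mul_assoc]
  · rw [K', cC]
    simp only [mul_assoc]
  · rw [K', cC]
    simp only [mul_assoc]
end

section
/- Yang–Baxter equation for two q-oscillator L-operators on Fock space: for all nonzero complex ζ₁, ζ₂, the equality R_{A,B}(ζ₁/ζ₂) L⁺_A(ζ₁) L⁺_B(ζ₂) = L⁺_B(ζ₂) L⁺_A(ζ₁) R_{A,B}(ζ₁/ζ₂) holds as linear operators on W⁺ ⊗ W⁺ ⊗ ℂ², where L⁺_A(x) acts on the first Fock factor and ℂ², L⁺_B(x) acts on the second Fock factor and ℂ², and R_{A,B}(x) acts on W⁺ ⊗ W⁺ and as identity on ℂ². The same identity holds with both L⁺ replaced by L⁻(x) := (1 ⊗ σ¹) L⁺(x) (1 ⊗ σ¹). -/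
open Finsupp

/-- The tensor product `W⁺ ⊗ W⁺` of two bosonic Fock spaces, modelled as finitely
supported functions on `ℕ × ℕ` (basis `e_j ⊗ e_k`). -/
abbrev FockSq : Type := (ℕ × ℕ) →₀ ℂ

/-- Endomorphisms of `W⁺ ⊗ W⁺`. -/
abbrev EndF : Type := Module.End ℂ FockSq

/-- The linear operator on `W⁺ ⊗ W⁺` determined by its values on basis vectors. -/
noncomputable def onB (f : ℕ × ℕ → FockSq) : EndF := Finsupp.linearCombination ℂ f

/-- `a⋆` acting on the first Fock factor: `a⋆ e_j = e_{j+1}`. -/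
noncomputable def asA : EndF := onB fun p => Finsupp.single (p.1 + 1, p.2) 1

/-- `a` acting on the first Fock factor: `a e_j = (1 − q^{2j}) e_{j−1}`, `a e₀ = 0`. -/
noncomputable def aA (q : ℂˣ) : EndF :=
  onB fun p => Finsupp.single (p.1 - 1, p.2) (1 - (q : ℂ) ^ (2 * p.1))

/-- `a⋆` acting on the second Fock factor. -/
noncomputable def asB : EndF := onB fun p => Finsupp.single (p.1, p.2 + 1) 1

/-- `a` acting on the second Fock factor. -/
noncomputable def aB (q : ℂˣ) : EndF :=
  onB fun p => Finsupp.single (p.1, p.2 - 1) (1 - (q : ℂ) ^ (2 * p.2))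

/-- `x^{D_A}`: `x^{D} e_j = x^j e_j` on the first Fock factor. -/
noncomputable def dA (x : ℂˣ) : EndF := onB fun p => Finsupp.single p ((x : ℂ) ^ p.1)

/-- `x^{D_B}` on the second Fock factor. -/
noncomputable def dB (x : ℂˣ) : EndF := onB fun p => Finsupp.single p ((x : ℂ) ^ p.2)

/-- The permutation `P_{A,B}` of the two Fock factors. -/
noncomputable def pAB : EndF := onB fun p => Finsupp.single (p.2, p.1) 1

/-- The locally nilpotent operator `u = a⋆_A q^{−2D_A} a_B`. -/
noncomputable def uOp (q : ℂˣ) : EndF := asA * dA (q⁻¹ ^ 2) * aB q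

/-- The coefficient of `uⁿ` in `h(x,u) = Σ_{n≥0} (−uq⁻¹)ⁿ ∏_{j=1}^{n}
(q^{j−1}x⁻¹ − q^{−j+1}x)/(qʲ − q⁻ʲ)`. -/
noncomputable def hCoeff (q x : ℂˣ) (n : ℕ) : ℂ :=
  (-(q : ℂ)⁻¹) ^ n *
    ∏ j ∈ Finset.range n,
      (((q : ℂ) ^ j * (x : ℂ)⁻¹ - ((q : ℂ)⁻¹) ^ j * (x : ℂ)) /
        ((q : ℂ) ^ (j + 1) - ((q : ℂ)⁻¹) ^ (j + 1)))

/-- The operator `h(x,u) = Σ_{n≥0} hCoeff(n) uⁿ`; since `uⁿ e_{(j,k)} = 0` for `n > k`,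
the locally finite sum is realized on the basis vector `e_{(j,k)}` as the finite sum
over `n ≤ k`. -/
noncomputable def hOp (q x : ℂˣ) : EndF :=
  onB fun p =>
    ∑ n ∈ Finset.range (p.2 + 1), hCoeff q x n • (uOp q ^ n) (Finsupp.single p 1)

/-- The R-matrix `R_{A,B}(x) = P_{A,B} ∘ h(x,u) ∘ x^{D_A + D_B}` on `W⁺ ⊗ W⁺`. -/
noncomputable def rAB (q x : ℂˣ) : EndF := pAB * hOp q x * (dA x * dB x)

/-- The q-oscillator L-operator `L⁺_A(x)` on `W⁺ ⊗ W⁺ ⊗ ℂ²`, written as a 2×2 matrix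
(in the `ℂ²` factor) of endomorphisms of `W⁺ ⊗ W⁺`, acting on the first Fock factor:
`L⁺(x) = [[1, −x a⋆],[−x a, 1 − x²q²q^{2D}]] ⬝ diag(q^D, q^{−D})`. -/
noncomputable def LAmat (q x : ℂˣ) : Matrix (Fin 2) (Fin 2) EndF :=
  !![1, -((x : ℂ) • asA);
     -((x : ℂ) • aA q), 1 - ((x : ℂ) ^ 2 * (q : ℂ) ^ 2) • dA (q ^ 2)] *
    !![dA q, 0; 0, dA q⁻¹]

/-- The q-oscillator L-operator `L⁺_B(x)`, acting on the second Fock factor. -/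
noncomputable def LBmat (q x : ℂˣ) : Matrix (Fin 2) (Fin 2) EndF :=
  !![1, -((x : ℂ) • asB);
     -((x : ℂ) • aB q), 1 - ((x : ℂ) ^ 2 * (q : ℂ) ^ 2) • dB (q ^ 2)] *
    !![dB q, 0; 0, dB q⁻¹]

/-- `R_{A,B}(x)` acting as identity on the `ℂ²` factor. -/
noncomputable def Rdiag (q x : ℂˣ) : Matrix (Fin 2) (Fin 2) EndF :=
  Matrix.diagonal fun _ => rAB q x

/-- `σ¹` acting in the `ℂ²` factor. -/
noncomputable def sigma1E : Matrix (Fin 2) (Fin 2) EndF := !![0, 1; 1, 0]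

/-- basis vector -/
noncomputable def eb (j k : ℕ) : FockSq := Finsupp.single (j, k) 1

lemma onB_eb (f : ℕ × ℕ → FockSq) (j k : ℕ) : onB f (eb j k) = f (j, k) := by
  simp [onB, eb]

lemma single_eb (j k : ℕ) (c : ℂ) : (Finsupp.single (j, k) c : FockSq) = c • eb j k := by
  simp [eb]

lemma asA_eb (j k : ℕ) : asA (eb j k) = eb (j + 1) k := by
  simp [asA, onB_eb, single_eb]
lemma asB_eb (j k : ℕ) : asB (eb j k) = eb j (k + 1) := by
  simp [asB, onB_eb, single_eb]
lemma aA_eb (q : ℂˣ) (j k : ℕ) :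
    aA q (eb j k) = (1 - (q : ℂ) ^ (2 * j)) • eb (j - 1) k := by
  rw [aA, onB_eb, single_eb]
lemma aB_eb (q : ℂˣ) (j k : ℕ) :
    aB q (eb j k) = (1 - (q : ℂ) ^ (2 * k)) • eb j (k - 1) := by
  rw [aB, onB_eb, single_eb]
lemma dA_eb (x : ℂˣ) (j k : ℕ) : dA x (eb j k) = (x : ℂ) ^ j • eb j k := by
  rw [dA, onB_eb, single_eb]
lemma dB_eb (x : ℂˣ) (j k : ℕ) : dB x (eb j k) = (x : ℂ) ^ k • eb j k := by
  rw [dB, onB_eb, single_eb]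
lemma pAB_eb (j k : ℕ) : pAB (eb j k) = eb k j := by
  rw [pAB, onB_eb, single_eb, one_smul]

lemma uOp_eb (q : ℂˣ) (j k : ℕ) :
    uOp q (eb j k) = ((1 - (q : ℂ) ^ (2 * k)) * ((q : ℂ)⁻¹ ^ 2) ^ j) • eb (j + 1) (k - 1) := by
  simp [uOp, aB_eb, dA_eb, asA_eb, smul_smul]

lemma end_ext {f g : EndF} (h : ∀ j k, f (eb j k) = g (eb j k)) : f = g := by
  apply Finsupp.lhom_ext'
  rintro ⟨j, k⟩
  apply LinearMap.ext_ring
  exact h j k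

lemma uOp_pow_eb_zero (q : ℂˣ) (n : ℕ) : ∀ j k : ℕ, k < n → (uOp q ^ n) (eb j k) = 0 := by
  induction n with
  | zero => intro j k h; omega
  | succ n ih =>
    intro j k h
    rw [pow_succ, Module.End.mul_apply, uOp_eb, map_smul]
    rcases Nat.eq_zero_or_pos k with hk | hk
    · subst hk; simp
    · rw [ih _ _ (by omega), smul_zero]

lemma fock_induction {p : FockSq → Prop} (h0 : p 0) (ha : ∀ v w, p v → p w → p (v + w))
    (hs : ∀ (c : ℂ) j k, p (c • eb j k)) (v : FockSq) : p v := by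
  induction v using Finsupp.induction_linear with
  | zero => exact h0
  | add f g hf hg => exact ha _ _ hf hg
  | single a b => obtain ⟨j, k⟩ := a; rw [single_eb]; exact hs _ _ _

lemma uOp_pow_eventually (q : ℂˣ) (v : FockSq) : ∃ N, ∀ n, N ≤ n → (uOp q ^ n) v = 0 := by
  induction v using fock_induction with
  | h0 => exact ⟨0, by simp⟩
  | ha v w hv hw =>
    obtain ⟨N, hN⟩ := hv
    obtain ⟨M, hM⟩ := hw
    exact ⟨N + M, fun n hn => by rw [map_add, hN n (by omega), hM n (by omega), add_zero]⟩
  | hs c j k =>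
    exact ⟨k + 1, fun n hn => by rw [map_smul, uOp_pow_eb_zero _ _ _ _ (by omega), smul_zero]⟩

/-- truncated `h` -/
noncomputable def hN (q x : ℂˣ) (N : ℕ) : EndF :=
  ∑ n ∈ Finset.range N, hCoeff q x n • uOp q ^ n

lemma hN_succ (q x : ℂˣ) (N : ℕ) :
    hN q x (N + 1) = hN q x N + hCoeff q x N • uOp q ^ N := by
  rw [hN, Finset.sum_range_succ, hN]

lemma hOp_eq_hN_eb (q x : ℂˣ) (j k N : ℕ) (h : k + 1 ≤ N) :
    hOp q x (eb j k) = hN q x N (eb j k) := by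
  induction N, h using Nat.le_induction with
  | base =>
    rw [hOp, onB_eb, hN, LinearMap.sum_apply]
    rfl
  | succ N hN' ih =>
    rw [hN_succ, LinearMap.add_apply, ← ih, LinearMap.smul_apply,
      uOp_pow_eb_zero _ _ _ _ (by omega), smul_zero, add_zero]

lemma hOp_eventually (q x : ℂˣ) (v : FockSq) :
    ∃ N, ∀ n, N ≤ n → hOp q x v = hN q x n v := by
  induction v using fock_induction with
  | h0 => exact ⟨0, by simp⟩
  | ha v w hv hw =>
    obtain ⟨N, hN⟩ := hv
    obtain ⟨M, hM⟩ := hw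
    exact ⟨N + M, fun n hn => by
      rw [map_add, map_add, hN n (by omega), hM n (by omega)]⟩
  | hs c j k =>
    exact ⟨k + 1, fun n hn => by
      rw [map_smul, map_smul, hOp_eq_hN_eb _ _ _ _ n (by omega)]⟩

/-- the intertwining criterion by telescoping -/
lemma intertwine (q x : ℂˣ) (X Y T : EndF) (V : ℕ → EndF)
    (h0 : hCoeff q x 0 • X = hCoeff q x 0 • Y + V 0 * T)
    (h1 : ∀ n, hCoeff q x (n + 1) • (uOp q ^ (n + 1) * X) + V n * uOp q ^ n * T =
      hCoeff q x (n + 1) • (Y * uOp q ^ (n + 1)) + V (n + 1) * uOp q ^ (n + 1) * T) :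
    hOp q x * X = Y * hOp q x := by
  have tel : ∀ N, hN q x (N + 1) * X = Y * hN q x (N + 1) + V N * uOp q ^ N * T := by
    intro N
    induction N with
    | zero =>
      have : hN q x (0 + 1) = hCoeff q x 0 • 1 := by simp [hN]
      rw [this, smul_mul_assoc, one_mul, mul_smul_comm, mul_one, pow_zero, mul_one, h0]
    | succ N ih =>
      rw [hN_succ, add_mul, mul_add, ih, smul_mul_assoc, mul_smul_comm, add_assoc, add_assoc,
        ← h1, add_comm (V N * uOp q ^ N * T)]
  apply LinearMap.ext
  intro v
  obtain ⟨N1, h1⟩ := hOp_eventually q x v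
  obtain ⟨N2, h2⟩ := hOp_eventually q x (X v)
  obtain ⟨N3, h3⟩ := uOp_pow_eventually q (T v)
  have := congrArg (fun f : EndF => f v) (tel (N1 + N2 + N3))
  simp only [LinearMap.add_apply, Module.End.mul_apply] at this
  rw [h3 _ (by omega), map_zero, ← h1 _ (by omega), ← h2 _ (by omega), add_zero] at this
  exact this

lemma intertwine_comm (q x : ℂˣ) (X : EndF) (h : uOp q * X = X * uOp q) :
    hOp q x * X = X * hOp q x := by
  have h' : ∀ n, uOp q ^ n * X = X * uOp q ^ n := fun n =>
    (Commute.pow_left (show Commute (uOp q) X from h) n)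
  apply intertwine q x X X 1 (fun _ => 0)
  · rw [zero_mul, add_zero]
  · intro n; rw [h', zero_mul, zero_mul, zero_mul, zero_mul]

lemma hCoeff_succ (q x : ℂˣ) (hq : ∀ n : ℕ, n ≠ 0 → (q : ℂ) ^ n ≠ 1) (n : ℕ) :
    ((q : ℂ) ^ (2 * (n + 1)) - 1) * hCoeff q x (n + 1) =
      ((x : ℂ) - (x : ℂ)⁻¹ * (q : ℂ) ^ (2 * n)) * hCoeff q x n := by
  have hq0 : (q : ℂ) ≠ 0 := q.ne_zero
  have hx0 : (x : ℂ) ≠ 0 := x.ne_zero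
  have h := hq (2 * (n + 1)) (by omega)
  have h2 : (q : ℂ) ^ (2 * (n + 1)) - 1 ≠ 0 := sub_ne_zero.mpr h
  have h3 : (q : ℂ) ^ (n + 1) - ((q : ℂ)⁻¹) ^ (n + 1) =
      ((q : ℂ) ^ (2 * (n + 1)) - 1) / (q : ℂ) ^ (n + 1) := by
    rw [inv_pow]
    field_simp
    ring
  unfold hCoeff
  rw [Finset.prod_range_succ, h3, neg_pow, neg_pow _ n]
  simp only [inv_pow]
  set P := ∏ j ∈ Finset.range n, (((q : ℂ) ^ j * (x : ℂ)⁻¹ - ((q : ℂ) ^ j)⁻¹ * (x : ℂ)) /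
        ((q : ℂ) ^ (j + 1) - ((q : ℂ) ^ (j + 1))⁻¹))
  field_simp
  ring

section relations
variable (q : ℂˣ)

/-- w = a⋆_A q^{-2D_A} -/
noncomputable def wO : EndF := asA * dA (q⁻¹ ^ 2)
/-- v -/
noncomputable def vO : EndF := asA * dA (q⁻¹ ^ 2) * dB (q ^ 2)
/-- g -/
noncomputable def gO : EndF := dA (q⁻¹ ^ 2) * aB q
/-- y -/
noncomputable def yO : EndF := aA q * asB * dA (q ^ 2)

lemma rel_w : uOp q * wO q = wO q * uOp q := by
  have hq0 : (q : ℂ) ≠ 0 := q.ne_zero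
  apply end_ext; intro j k
  simp [wO, uOp_eb, asA_eb, dA_eb]
  match_scalars <;> field_simp <;> try ring
lemma rel_aB : uOp q * aB q = aB q * uOp q := by
  have hq0 : (q : ℂ) ≠ 0 := q.ne_zero
  apply end_ext; intro j k
  simp [uOp_eb, aB_eb]
  match_scalars <;> field_simp <;> try ring
lemma rel_v : uOp q * vO q = (q : ℂ) ^ 2 • (vO q * uOp q) := by
  have hq0 : (q : ℂ) ≠ 0 := q.ne_zero
  apply end_ext; intro j k
  rcases k with _ | k <;>
  simp [vO, uOp_eb, asA_eb, dA_eb, dB_eb]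
  match_scalars <;> field_simp <;> try ring
lemma rel_g : uOp q * gO q = (q : ℂ) ^ 2 • (gO q * uOp q) := by
  have hq0 : (q : ℂ) ≠ 0 := q.ne_zero
  apply end_ext; intro j k
  rcases k with _ | k <;>
  simp [gO, uOp_eb, aB_eb, dA_eb, dB_eb]
  match_scalars <;> field_simp <;> try ring
lemma rel_dA : uOp q * dA (q ^ 2) = ((q : ℂ) ^ 2)⁻¹ • (dA (q ^ 2) * uOp q) := by
  have hq0 : (q : ℂ) ≠ 0 := q.ne_zero
  apply end_ext; intro j k
  simp [uOp_eb, dA_eb]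
  match_scalars <;> field_simp <;> try ring
lemma rel_dB : uOp q * dB (q ^ 2) = (q : ℂ) ^ 2 • (dB (q ^ 2) * uOp q) := by
  have hq0 : (q : ℂ) ≠ 0 := q.ne_zero
  apply end_ext; intro j k
  rcases k with _ | k <;>
  simp [uOp_eb, dB_eb]
  match_scalars <;> field_simp <;> try ring
lemma rel_asB : uOp q * asB = asB * uOp q + (1 - (q : ℂ) ^ 2) • vO q := by
  have hq0 : (q : ℂ) ≠ 0 := q.ne_zero
  apply end_ext; intro j k
  rcases k with _ | k <;>
  simp [vO, uOp_eb, asA_eb, asB_eb, dA_eb, dB_eb] <;>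
  match_scalars <;> field_simp <;> try ring
lemma rel_asB_u : asB * uOp q = wO q + (-1 : ℂ) • vO q := by
  have hq0 : (q : ℂ) ≠ 0 := q.ne_zero
  apply end_ext; intro j k
  rcases k with _ | k <;>
  simp [wO, vO, uOp_eb, asA_eb, asB_eb, dA_eb, dB_eb] <;>
  match_scalars <;> field_simp <;> try ring
lemma rel_aA : uOp q * aA q = aA q * uOp q + ((q : ℂ) ^ 2 - 1) • gO q := by
  have hq0 : (q : ℂ) ≠ 0 := q.ne_zero
  apply end_ext; intro j k
  rcases j with _ | j <;>
  simp [gO, uOp_eb, aA_eb, aB_eb, dA_eb, dB_eb] <;>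
  match_scalars <;> field_simp <;> try ring
lemma rel_y : uOp q * yO q = yO q * uOp q +
    ((q : ℂ) ^ 2 * ((q : ℂ) ^ 2 - 1)) • dA (q ^ 2) +
    (-((q : ℂ) ^ 2 * ((q : ℂ) ^ 2 - 1))) • dB (q ^ 2) := by
  have hq0 : (q : ℂ) ≠ 0 := q.ne_zero
  apply end_ext; intro j k
  rcases j with _ | j <;> rcases k with _ | k <;>
  simp [yO, uOp_eb, aA_eb, asB_eb, dA_eb, dB_eb] <;>
  match_scalars <;> field_simp <;> try ring

lemma pow_comm_smul (u X : EndF) (c : ℂ) (h : u * X = c • (X * u)) (n : ℕ) :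
    u ^ n * X = c ^ n • (X * u ^ n) := by
  induction n with
  | zero => simp
  | succ n ih =>
    rw [pow_succ', mul_assoc, ih, mul_smul_comm, ← mul_assoc, h, smul_mul_assoc, smul_smul,
      mul_assoc, pow_succ]

/-- general commutator induction -/
lemma pow_comm_add (u X V : EndF) (c d : ℂ) (h : u * X = X * u + d • V)
    (hV : u * V = c • (V * u)) (n : ℕ) :
    u ^ (n + 1) * X = X * u ^ (n + 1) +
      (d * ∑ i ∈ Finset.range (n + 1), c ^ i) • (V * u ^ n) := by
  induction n with
  | zero => simp [h]
  | succ n ih =>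
    rw [pow_succ' u (n + 1), mul_assoc, ih, mul_add, ← mul_assoc, h, mul_smul_comm,
      ← mul_assoc u V, hV, add_mul, smul_mul_assoc, smul_mul_assoc, mul_assoc V u, ← pow_succ',
      mul_assoc X u, ← pow_succ', smul_smul, add_assoc, ← add_smul, Finset.sum_range_succ' _ (n + 1)]
    congr 2
    simp only [pow_succ, pow_zero, ← Finset.sum_mul]
    ring

/-- general commutator induction, two terms -/
lemma pow_comm_add2 (u X V W : EndF) (c d c' d' : ℂ) (h : u * X = X * u + d • V + d' • W)
    (hV : u * V = c • (V * u)) (hW : u * W = c' • (W * u)) (n : ℕ) :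
    u ^ (n + 1) * X = X * u ^ (n + 1) +
      (d * ∑ i ∈ Finset.range (n + 1), c ^ i) • (V * u ^ n) +
      (d' * ∑ i ∈ Finset.range (n + 1), c' ^ i) • (W * u ^ n) := by
  induction n with
  | zero => simp [h]
  | succ n ih =>
    rw [pow_succ' u (n + 1), mul_assoc, ih, mul_add, mul_add, ← mul_assoc, h, mul_smul_comm,
      mul_smul_comm, ← mul_assoc u V, hV, ← mul_assoc u W, hW, add_mul, add_mul,
      smul_mul_assoc, smul_mul_assoc, smul_mul_assoc, smul_mul_assoc, mul_assoc V u, ← pow_succ',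
      mul_assoc W u, ← pow_succ', mul_assoc X u, ← pow_succ', smul_smul, smul_smul,
      Finset.sum_range_succ' _ (n + 1), Finset.sum_range_succ' _ (n + 1)]
    simp only [pow_succ c, pow_succ c', pow_zero, ← Finset.sum_mul]
    module

end relations

lemma mul_pow_smul (u T : EndF) (c : ℂ) (h : T * u = c • (u * T)) (n : ℕ) :
    T * u ^ n = c ^ n • (u ^ n * T) := by
  induction n with
  | zero => simp
  | succ n ih =>
    rw [pow_succ, ← mul_assoc, ih, smul_mul_assoc, mul_assoc, h, mul_smul_comm, smul_smul,
      mul_assoc, pow_succ]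

section entries
variable (q : ℂˣ)

/-- the Cartan part -/
noncomputable def tO (x y : ℂˣ) : EndF := dA x * dB y

lemma rel_t12 : tO q q⁻¹ * uOp q = (q : ℂ) ^ 2 • (uOp q * tO q q⁻¹) := by
  have hq0 : (q : ℂ) ≠ 0 := q.ne_zero
  apply end_ext; intro j k
  rcases k with _ | k <;>
  simp [tO, uOp_eb, dA_eb, dB_eb]
  match_scalars
  field_simp
  try ring
lemma rel_t21 : tO q q * uOp q = (1 : ℂ) • (uOp q * tO q q) := by
  have hq0 : (q : ℂ) ≠ 0 := q.ne_zero
  apply end_ext; intro j k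
  rcases k with _ | k <;>
  simp [tO, uOp_eb, dA_eb, dB_eb]
  match_scalars
  field_simp
  try ring
lemma rel_t22 : tO q⁻¹ q⁻¹ * uOp q = (1 : ℂ) • (uOp q * tO q⁻¹ q⁻¹) := by
  have hq0 : (q : ℂ) ≠ 0 := q.ne_zero
  apply end_ext; intro j k
  rcases k with _ | k <;>
  simp [tO, uOp_eb, dA_eb, dB_eb]
  match_scalars
  field_simp
  try ring

lemma inter12 (hq : ∀ n : ℕ, n ≠ 0 → (q : ℂ) ^ n ≠ 1) (ζ₁ ζ₂ : ℂˣ) :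
    hOp q (ζ₁ * ζ₂⁻¹) * (((-ζ₁ : ℂ) • asB + (-(ζ₁ : ℂ) ^ 2 * (ζ₂ : ℂ)⁻¹) • wO q
        + ((ζ₁ : ℂ) ^ 2 * ζ₂ * (q : ℂ) ^ 2) • vO q) * tO q q⁻¹) =
      (((-ζ₁ : ℂ) • asB + (-(ζ₂ : ℂ)) • wO q
        + ((ζ₁ : ℂ) ^ 2 * ζ₂ * (q : ℂ) ^ 2) • vO q) * tO q q⁻¹) * hOp q (ζ₁ * ζ₂⁻¹) := by
  have h1 : (ζ₁ : ℂ) ≠ 0 := ζ₁.ne_zero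
  have h2 : (ζ₂ : ℂ) ≠ 0 := ζ₂.ne_zero
  set x := ζ₁ * ζ₂⁻¹ with hx
  have hxv : (x : ℂ) = ζ₁ * (ζ₂ : ℂ)⁻¹ := by simp [hx]
  set u := uOp q with hu
  set T := tO q q⁻¹ with hT
  apply intertwine q x _ _ T (fun n => (-(hCoeff q x n) *
    ((ζ₁ : ℂ) ^ 2 * (ζ₂ : ℂ)⁻¹ - ζ₂ * (q : ℂ) ^ (2 * n))) • wO q)
  · simp only [add_mul, smul_mul_assoc]
    module
  · intro n
    have hc := hCoeff_succ q x hq n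
    rw [hxv] at hc
    have hd : ζ₁ * ((q : ℂ) ^ (2 * (n + 1)) - 1) * hCoeff q x (n + 1) =
        ((ζ₁ : ℂ) ^ 2 * (ζ₂ : ℂ)⁻¹ - ζ₂ * (q : ℂ) ^ (2 * n)) * hCoeff q x n := by
      rw [mul_assoc, hc]
      field_simp
    have e1 : u ^ (n + 1) * asB = wO q * u ^ n + (-(q : ℂ) ^ (2 * (n + 1))) • (vO q * u ^ n) := by
      rw [pow_comm_add u asB (vO q) _ _ (rel_asB q) (rel_v q), pow_succ' u, ← mul_assoc,
        rel_asB_u, add_mul, smul_mul_assoc, add_assoc, ← add_smul]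
      congr 2
      have := mul_geom_sum ((q : ℂ) ^ 2) (n + 1)
      rw [← pow_mul] at this
      linear_combination -this
    have e2 : asB * u ^ (n + 1) = wO q * u ^ n + (-1 : ℂ) • (vO q * u ^ n) := by
      rw [pow_succ' u, ← mul_assoc, rel_asB_u, add_mul, smul_mul_assoc]
    have e3 : u ^ (n + 1) * wO q = wO q * u ^ (n + 1) :=
      (Commute.pow_left (show Commute u (wO q) from rel_w q) _)
    have e4 := pow_comm_smul u (vO q) _ (rel_v q) (n + 1)
    have e5 := mul_pow_smul u T _ (rel_t12 q) (n + 1)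
    rw [mul_assoc _ T, e5, ← mul_assoc]
    simp only [mul_add, add_mul, mul_smul_comm, smul_mul_assoc, ← hu, ← mul_assoc]
    simp only [e1, e2, e3, e4]
    simp only [add_mul, smul_mul_assoc, mul_assoc, ← hu]
    match_scalars
    · linear_combination hd
    all_goals ring

lemma inter21 (hq : ∀ n : ℕ, n ≠ 0 → (q : ℂ) ^ n ≠ 1) (ζ₁ ζ₂ : ℂˣ) :
    hOp q (ζ₁ * ζ₂⁻¹) * (((-ζ₂ : ℂ) • aA q + (-(ζ₂ : ℂ) ^ 2 * (ζ₁ : ℂ)⁻¹) • gO q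
        + ((ζ₂ : ℂ) ^ 2 * ζ₁ * (q : ℂ) ^ 2) • aB q) * tO q q) =
      (((-ζ₂ : ℂ) • aA q + (-(ζ₁ : ℂ)) • gO q
        + ((ζ₂ : ℂ) ^ 2 * ζ₁ * (q : ℂ) ^ 2) • aB q) * tO q q) * hOp q (ζ₁ * ζ₂⁻¹) := by
  have h1 : (ζ₁ : ℂ) ≠ 0 := ζ₁.ne_zero
  have h2 : (ζ₂ : ℂ) ≠ 0 := ζ₂.ne_zero
  set x := ζ₁ * ζ₂⁻¹ with hx
  have hxv : (x : ℂ) = ζ₁ * (ζ₂ : ℂ)⁻¹ := by simp [hx]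
  set u := uOp q with hu
  set T := tO q q with hT
  apply intertwine q x _ _ T (fun n => ((hCoeff q x n) *
    (ζ₁ - (ζ₂ : ℂ) ^ 2 * (ζ₁ : ℂ)⁻¹ * (q : ℂ) ^ (2 * n))) • gO q)
  · simp only [add_mul, smul_mul_assoc]
    module
  · intro n
    have hc := hCoeff_succ q x hq n
    rw [hxv] at hc
    have hd : ζ₂ * ((q : ℂ) ^ (2 * (n + 1)) - 1) * hCoeff q x (n + 1) =
        (ζ₁ - (ζ₂ : ℂ) ^ 2 * (ζ₁ : ℂ)⁻¹ * (q : ℂ) ^ (2 * n)) * hCoeff q x n := by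
      rw [mul_assoc, hc]
      field_simp
    have e1 : u ^ (n + 1) * aA q = aA q * u ^ (n + 1) +
        ((q : ℂ) ^ (2 * (n + 1)) - 1) • (gO q * u ^ n) := by
      rw [pow_comm_add u (aA q) (gO q) _ _ (rel_aA q) (rel_g q), mul_geom_sum, ← pow_mul]
    have e3 : u ^ (n + 1) * aB q = aB q * u ^ (n + 1) :=
      (Commute.pow_left (show Commute u (aB q) from rel_aB q) _)
    have e4 := pow_comm_smul u (gO q) _ (rel_g q) (n + 1)
    have e5 := mul_pow_smul u T _ (rel_t21 q) (n + 1)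
    rw [mul_assoc _ T, e5, ← mul_assoc]
    simp only [mul_add, add_mul, mul_smul_comm, smul_mul_assoc, ← hu, ← mul_assoc]
    simp only [e1, e3, e4]
    simp only [add_mul, smul_mul_assoc, mul_assoc, ← hu]
    match_scalars
    · ring
    · linear_combination -hd
    all_goals ring

lemma inter22 (hq : ∀ n : ℕ, n ≠ 0 → (q : ℂ) ^ n ≠ 1) (ζ₁ ζ₂ : ℂˣ) :
    hOp q (ζ₁ * ζ₂⁻¹) * (((ζ₁ * ζ₂ : ℂ) • yO q + (1 : ℂ) • 1
        + (-(ζ₁ : ℂ) ^ 2 * (q : ℂ) ^ 2) • dA (q ^ 2)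
        + (-(ζ₂ : ℂ) ^ 2 * (q : ℂ) ^ 2) • dB (q ^ 2)
        + ((ζ₁ : ℂ) ^ 2 * (ζ₂ : ℂ) ^ 2 * (q : ℂ) ^ 4) • (dA (q ^ 2) * dB (q ^ 2))) *
          tO q⁻¹ q⁻¹) =
      (((ζ₁ * ζ₂ : ℂ) • yO q + (1 : ℂ) • 1
        + (-(ζ₂ : ℂ) ^ 2 * (q : ℂ) ^ 2) • dA (q ^ 2)
        + (-(ζ₁ : ℂ) ^ 2 * (q : ℂ) ^ 2) • dB (q ^ 2)
        + ((ζ₁ : ℂ) ^ 2 * (ζ₂ : ℂ) ^ 2 * (q : ℂ) ^ 4) • (dA (q ^ 2) * dB (q ^ 2))) *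
          tO q⁻¹ q⁻¹) * hOp q (ζ₁ * ζ₂⁻¹) := by
  have h1 : (ζ₁ : ℂ) ≠ 0 := ζ₁.ne_zero
  have h2 : (ζ₂ : ℂ) ≠ 0 := ζ₂.ne_zero
  have hq0 : (q : ℂ) ≠ 0 := q.ne_zero
  set x := ζ₁ * ζ₂⁻¹ with hx
  have hxv : (x : ℂ) = ζ₁ * (ζ₂ : ℂ)⁻¹ := by simp [hx]
  set u := uOp q with hu
  set T := tO q⁻¹ q⁻¹ with hT
  apply intertwine q x _ _ T (fun n => ((hCoeff q x n) * (q : ℂ) ^ 2 *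
    ((ζ₁ : ℂ) ^ 2 - (ζ₂ : ℂ) ^ 2 * (q : ℂ) ^ (2 * n))) •
      (dB (q ^ 2) + (-((q : ℂ) ^ (2 * n))⁻¹) • dA (q ^ 2)))
  · simp only [add_mul, smul_mul_assoc, smul_add]
    match_scalars <;> simp <;> ring
  · intro n
    have hc := hCoeff_succ q x hq n
    rw [hxv] at hc
    have hd : ζ₁ * ζ₂ * ((q : ℂ) ^ (2 * (n + 1)) - 1) * hCoeff q x (n + 1) =
        ((ζ₁ : ℂ) ^ 2 - (ζ₂ : ℂ) ^ 2 * (q : ℂ) ^ (2 * n)) * hCoeff q x n := by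
      rw [mul_assoc, hc]
      field_simp
    have e1 : u ^ (n + 1) * yO q = yO q * u ^ (n + 1) +
        ((q : ℂ) ^ 2 * ((q : ℂ) ^ (2 * (n + 1)) - 1) * ((q : ℂ) ^ (2 * n))⁻¹) •
          (dA (q ^ 2) * u ^ n) +
        (-((q : ℂ) ^ 2 * ((q : ℂ) ^ (2 * (n + 1)) - 1))) • (dB (q ^ 2) * u ^ n) := by
      rw [pow_comm_add2 u (yO q) _ _ _ _ _ _ (rel_y q) (rel_dA q) (rel_dB q)]
      have g1 := mul_geom_sum ((q : ℂ) ^ 2) (n + 1)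
      have g2 := mul_geom_sum (((q : ℂ) ^ 2)⁻¹) (n + 1)
      rw [← pow_mul] at g1
      have g3 : ((q : ℂ) ^ 2 - 1) * ∑ i ∈ Finset.range (n + 1), (((q : ℂ) ^ 2)⁻¹) ^ i =
        ((q : ℂ) ^ (2 * (n + 1)) - 1) * ((q : ℂ) ^ (2 * n))⁻¹ := by
        have : ((q : ℂ) ^ 2 - 1) = -(q : ℂ) ^ 2 * (((q : ℂ) ^ 2)⁻¹ - 1) := by
          field_simp
          ring
        rw [this, mul_assoc, g2, inv_pow, ← pow_mul]
        field_simp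
        ring
      congr 2
      · rw [mul_assoc, g3, mul_assoc]
      · rw [neg_mul, mul_assoc, g1]
    have e3 := pow_comm_smul u _ _ (rel_dA q) (n + 1)
    have e4 := pow_comm_smul u _ _ (rel_dB q) (n + 1)
    have e6 : u ^ (n + 1) * (dA (q ^ 2) * dB (q ^ 2)) =
        dA (q ^ 2) * dB (q ^ 2) * u ^ (n + 1) := by
      rw [← mul_assoc, e3, smul_mul_assoc, mul_assoc, e4, mul_smul_comm, smul_smul, ← mul_pow,
        inv_mul_cancel₀ (pow_ne_zero 2 hq0), one_pow, one_smul, mul_assoc]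
    have e5 := mul_pow_smul u T _ (rel_t22 q) (n + 1)
    rw [mul_assoc _ T, e5, mul_smul_comm, ← mul_assoc _ (u ^ (n + 1)) T]
    simp only [mul_add, add_mul, mul_smul_comm, smul_mul_assoc, ← hu, ← mul_assoc (u ^ (n + 1)) _ T]
    simp only [e1, e3, e4, e6, smul_add, mul_one, one_mul]
    simp only [add_mul, smul_mul_assoc, mul_assoc, ← hu]
    match_scalars
    · ring
    · linear_combination (q : ℂ) ^ 2 * ((q : ℂ) ^ (2 * n))⁻¹ * hd
    · linear_combination -(q : ℂ) ^ 2 * hd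
    · ring
    · rw [inv_pow, ← pow_mul]
      field_simp
      ring
    all_goals ring

lemma inter11 (x : ℂˣ) (c : ℂ) :
    hOp q x * (tO q q + c • (wO q * aB q * tO q q)) =
      (tO q q + c • (wO q * aB q * tO q q)) * hOp q x := by
  apply intertwine_comm
  have e : uOp q * tO q q = tO q q * uOp q := by rw [rel_t21, one_smul]
  have e2 : uOp q * (wO q * aB q) = wO q * aB q * uOp q := by
    rw [← mul_assoc, rel_w, mul_assoc, rel_aB, mul_assoc]
  rw [mul_add, add_mul, e, mul_smul_comm, smul_mul_assoc, ← mul_assoc, e2, mul_assoc _ (uOp q),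
    e, mul_assoc _ _ (uOp q)]

end entries

lemma assemble (q x : ℂˣ) (M M' X Y : EndF) (h1 : dA x * dB x * M = X * (dA x * dB x))
    (h2 : M' * pAB = pAB * Y) (h : hOp q x * X = Y * hOp q x) :
    rAB q x * M = M' * rAB q x := by
  rw [rAB, mul_assoc, h1, ← mul_assoc, mul_assoc pAB, h, ← mul_assoc pAB, ← h2]
  simp only [mul_assoc]

set_option maxHeartbeats 2000000 in
lemma yb_plus (q : ℂˣ)
    (hq : ∀ n : ℕ, n ≠ 0 → (q : ℂ) ^ n ≠ 1) (ζ₁ ζ₂ : ℂˣ) :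
    Rdiag q (ζ₁ * ζ₂⁻¹) * (LAmat q ζ₁ * LBmat q ζ₂) =
        (LBmat q ζ₂ * LAmat q ζ₁) * Rdiag q (ζ₁ * ζ₂⁻¹) := by
  have h1 : (ζ₁ : ℂ) ≠ 0 := ζ₁.ne_zero
  have h2 : (ζ₂ : ℂ) ≠ 0 := ζ₂.ne_zero
  have hq0 : (q : ℂ) ≠ 0 := q.ne_zero
  ext1 a b
  rw [Rdiag, Matrix.diagonal_mul, Matrix.mul_diagonal]
  fin_cases a <;> fin_cases b
  · refine assemble q _ _ _ _ _ ?_ ?_ (inter11 q _ (ζ₁ * ζ₂))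
    · apply end_ext; intro j k
      rcases k with _ | k <;>
      simp [LAmat, LBmat, Matrix.mul_apply, Fin.sum_univ_two, tO, wO, asA_eb, asB_eb, aA_eb,
        aB_eb, dA_eb, dB_eb] <;>
      match_scalars <;> (try simp only [mul_pow, inv_pow]) <;> field_simp <;> try ring
    · apply end_ext; intro j k
      rcases k with _ | k <;> rcases j with _ | j <;>
      simp [LAmat, LBmat, Matrix.mul_apply, Fin.sum_univ_two, tO, wO, asA_eb, asB_eb, aA_eb,
        aB_eb, dA_eb, dB_eb, pAB_eb] <;>
      match_scalars <;> (try simp only [mul_pow, inv_pow]) <;> field_simp <;> try ring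
  · refine assemble q _ _ _ _ _ ?_ ?_ (inter12 q hq ζ₁ ζ₂)
    · apply end_ext; intro j k
      rcases k with _ | k <;>
      simp [LAmat, LBmat, Matrix.mul_apply, Fin.sum_univ_two, tO, wO, vO, asA_eb, asB_eb, aA_eb,
        aB_eb, dA_eb, dB_eb] <;>
      match_scalars <;> (try simp only [mul_pow, inv_pow]) <;> field_simp <;> try ring
    · apply end_ext; intro j k
      rcases k with _ | k <;> rcases j with _ | j <;>
      simp [LAmat, LBmat, Matrix.mul_apply, Fin.sum_univ_two, tO, wO, vO, asA_eb, asB_eb, aA_eb,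
        aB_eb, dA_eb, dB_eb, pAB_eb] <;>
      match_scalars <;> (try simp only [mul_pow, inv_pow]) <;> field_simp <;> try ring
  · refine assemble q _ _ _ _ _ ?_ ?_ (inter21 q hq ζ₁ ζ₂)
    · apply end_ext; intro j k
      rcases k with _ | k <;> rcases j with _ | j <;>
      simp [LAmat, LBmat, Matrix.mul_apply, Fin.sum_univ_two, tO, gO, asA_eb, asB_eb, aA_eb,
        aB_eb, dA_eb, dB_eb] <;>
      match_scalars <;> (try simp only [mul_pow, inv_pow]) <;> field_simp <;> try ring
    · apply end_ext; intro j k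
      rcases k with _ | k <;> rcases j with _ | j <;>
      simp [LAmat, LBmat, Matrix.mul_apply, Fin.sum_univ_two, tO, gO, asA_eb, asB_eb, aA_eb,
        aB_eb, dA_eb, dB_eb, pAB_eb] <;>
      match_scalars <;> (try simp only [mul_pow, inv_pow]) <;> field_simp <;> try ring
  · refine assemble q _ _ _ _ _ ?_ ?_ (inter22 q hq ζ₁ ζ₂)
    · apply end_ext; intro j k
      rcases k with _ | k <;> rcases j with _ | j <;>
      simp [LAmat, LBmat, Matrix.mul_apply, Fin.sum_univ_two, tO, yO, asA_eb, asB_eb, aA_eb,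
        aB_eb, dA_eb, dB_eb] <;>
      match_scalars <;> (try simp only [mul_pow, inv_pow]) <;> field_simp <;> try ring
    · apply end_ext; intro j k
      rcases k with _ | k <;> rcases j with _ | j <;>
      simp [LAmat, LBmat, Matrix.mul_apply, Fin.sum_univ_two, tO, yO, asA_eb, asB_eb, aA_eb,
        aB_eb, dA_eb, dB_eb, pAB_eb] <;>
      match_scalars <;> (try simp only [mul_pow, inv_pow]) <;> field_simp <;> try ring

lemma sigma_sq : sigma1E * sigma1E = 1 := by
  ext1 a b
  fin_cases a <;> fin_cases b <;> simp [sigma1E, Matrix.mul_apply, Fin.sum_univ_two]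

lemma sigma_R (q x : ℂˣ) : Rdiag q x * sigma1E = sigma1E * Rdiag q x := by
  ext1 a b
  rw [Rdiag, Matrix.diagonal_mul, Matrix.mul_diagonal]
  fin_cases a <;> fin_cases b <;> simp [sigma1E]


/-- Yang–Baxter equation for two q-oscillator L-operators on Fock space:
`R_{A,B}(ζ₁/ζ₂) L^±_A(ζ₁) L^±_B(ζ₂) = L^±_B(ζ₂) L^±_A(ζ₁) R_{A,B}(ζ₁/ζ₂)` as linear
operators on `W⁺ ⊗ W⁺ ⊗ ℂ²` (represented as 2×2 matrices over `End(W⁺ ⊗ W⁺)`),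
where `L⁻(x) = (1 ⊗ σ¹) L⁺(x) (1 ⊗ σ¹)`; `q` is not a root of unity. -/
theorem yang_baxter_q_oscillator (q : ℂˣ)
    (hq : ∀ n : ℕ, n ≠ 0 → (q : ℂ) ^ n ≠ 1) (ζ₁ ζ₂ : ℂˣ) :
    (Rdiag q (ζ₁ * ζ₂⁻¹) * LAmat q ζ₁ * LBmat q ζ₂ =
        LBmat q ζ₂ * LAmat q ζ₁ * Rdiag q (ζ₁ * ζ₂⁻¹)) ∧
      (Rdiag q (ζ₁ * ζ₂⁻¹) * (sigma1E * LAmat q ζ₁ * sigma1E) *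
          (sigma1E * LBmat q ζ₂ * sigma1E) =
        (sigma1E * LBmat q ζ₂ * sigma1E) * (sigma1E * LAmat q ζ₁ * sigma1E) *
          Rdiag q (ζ₁ * ζ₂⁻¹)) := by
  have key := yb_plus q hq ζ₁ ζ₂
  have hs := sigma_sq
  have hR := sigma_R q (ζ₁ * ζ₂⁻¹)
  have c : ∀ A B : Matrix (Fin 2) (Fin 2) EndF,
      (sigma1E * A * sigma1E) * (sigma1E * B * sigma1E) = sigma1E * (A * B) * sigma1E := by
    intro A B
    calc (sigma1E * A * sigma1E) * (sigma1E * B * sigma1E)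
        = sigma1E * A * (sigma1E * sigma1E) * B * sigma1E := by simp only [mul_assoc]
      _ = _ := by rw [hs, mul_one]; simp only [mul_assoc]
  refine ⟨by rw [mul_assoc]; exact key, ?_⟩
  rw [mul_assoc, c, c, ← mul_assoc, ← mul_assoc, hR, mul_assoc sigma1E, key, mul_assoc _ sigma1E,
    ← hR]
  simp only [mul_assoc]
end
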